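/- Let M ⊨ T_MSO(Fin) and suppose that M ≈_k MSO(n) for some k, n ∈ ℕ. Then M ⊗ MSO(1) ≈_k MSO(n+1). -/

import Mathlib

open FirstOrder FirstOrder.Language

namespace MSO

/-! ### The language `L_⊗` and its semantics -/

/-- The language `L_⊗`: a constant `⊥`, a unary relation `At`,
and two binary relations: `⊆` (encoded `true`) and `≤ᴱ` (encoded `false`). -/
def Lmso : Language where
  Functions := fun n => match n with | 0 => Unit | _ => Empty
  Relations := fun n => match n with | 1 => Unit | 2 => Bool | _ => Empty

/-- The constant symbol `⊥`. -/
def botC : Lmso.Constants := Unit.unit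
/-- The unary relation symbol `At`. -/
def atR : Lmso.Relations 1 := Unit.unit
/-- The binary relation symbol `⊆`. -/
def subR : Lmso.Relations 2 := true
/-- The binary relation symbol `≤ᴱ`. -/
def exleR : Lmso.Relations 2 := false

/-- The interpretation of `⊥` in an `L_⊗`-structure. -/
def botE (M : Type*) [Lmso.Structure M] : M := Structure.funMap botC ![]
/-- The interpretation of `At` in an `L_⊗`-structure. -/
def atE {M : Type*} [Lmso.Structure M] (a : M) : Prop := Structure.RelMap atR ![a]
/-- The interpretation of `⊆` in an `L_⊗`-structure. -/
def subE {M : Type*} [Lmso.Structure M] (a b : M) : Prop := Structure.RelMap subR ![a, b]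
/-- The interpretation of `≤ᴱ` in an `L_⊗`-structure. -/
def exleE {M : Type*} [Lmso.Structure M] (a b : M) : Prop := Structure.RelMap exleR ![a, b]

/-- The monadic second order version `M̃SO(α)` of a linear order `α`, as an `L_⊗`-structure:
the universe is the powerset of `α`, `⊆` is inclusion, `⊥` is `∅`, `At` holds of singletons,
and `A ≤ᴱ B` iff there are `a ∈ A` and `b ∈ B` with `a < b`. -/
instance msoStructure (α : Type*) [LinearOrder α] : Lmso.Structure (Set α) where
  funMap := fun {n} f _ => match n, f with
    | 0, _ => (∅ : Set α)
  RelMap := fun {n} r v => match n, r with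
    | 1, _ => ∃ a : α, v 0 = {a}
    | 2, true => v 0 ⊆ v 1
    | 2, false => ∃ a ∈ v 0, ∃ b ∈ v 1, a < b

/-- `MSO(n)`, the monadic second order version of the `n`-element linear order. -/
abbrev MSOn (n : ℕ) : Type := Set (Fin n)

/-- The operation `⊗` on `L_⊗`-structures: the universe is the product, `⊆` is componentwise,
`⊥` is the pair of bottoms, `At` holds of the atoms (minimal non-bottom elements) of the
resulting order, and `(A,B) ≤ᴱ (C,D)` iff (`A ≠ ⊥` and `D ≠ ⊥`), or `A ≤ᴱ C`, or `B ≤ᴱ D`. -/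
instance tensorStructure (M N : Type*) [Lmso.Structure M] [Lmso.Structure N] :
    Lmso.Structure (M × N) where
  funMap := fun {n} f _ => match n, f with
    | 0, _ => (botE M, botE N)
  RelMap := fun {n} r v => match n, r with
    | 1, _ => v 0 ≠ (botE M, botE N) ∧
        ∀ q : M × N, subE q.1 (v 0).1 → subE q.2 (v 0).2 →
          q = (botE M, botE N) ∨ q = v 0
    | 2, true => subE (v 0).1 (v 1).1 ∧ subE (v 0).2 (v 1).2
    | 2, false => ((v 0).1 ≠ botE M ∧ (v 1).2 ≠ botE N) ∨
        exleE (v 0).1 (v 1).1 ∨ exleE (v 0).2 (v 1).2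

/-! ### Formulas -/

/-- Bounded `L_⊗`-formulas with no free (outer) variables. -/
abbrev BF (n : ℕ) := Lmso.BoundedFormula Empty n

/-- The `i`-th de Bruijn variable as a term. -/
def tv {n : ℕ} (i : Fin n) : Lmso.Term (Empty ⊕ Fin n) := Term.var (Sum.inr i)
/-- The constant `⊥` as a term. -/
def tb {n : ℕ} : Lmso.Term (Empty ⊕ Fin n) := Constants.term botC

def sub' {n : ℕ} (i j : Fin n) : BF n := subR.boundedFormula₂ (tv i) (tv j)
def exle' {n : ℕ} (i j : Fin n) : BF n := exleR.boundedFormula₂ (tv i) (tv j)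
def at' {n : ℕ} (i : Fin n) : BF n := atR.boundedFormula₁ (tv i)
def eq' {n : ℕ} (i j : Fin n) : BF n := Term.bdEqual (tv i) (tv j)
def isBot' {n : ℕ} (i : Fin n) : BF n := Term.bdEqual (tv i) tb
def botSub' {n : ℕ} (i : Fin n) : BF n := subR.boundedFormula₂ tb (tv i)

/-- Finite conjunction. -/
def bigAnd {n : ℕ} (l : List (BF n)) : BF n := l.foldr (· ⊓ ·) ⊤
/-- Finite disjunction. -/
def bigOr {n : ℕ} (l : List (BF n)) : BF n := l.foldr (· ⊔ ·) ⊥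

/-- `k` is the meet of `i` and `j` (with respect to `⊆`). -/
def isMeet {n : ℕ} (k i j : Fin n) : BF n :=
  sub' k i ⊓ sub' k j ⊓
    ∀' ((sub' (Fin.last n) i.castSucc ⊓ sub' (Fin.last n) j.castSucc) ⟹
      sub' (Fin.last n) k.castSucc)

/-- `k` is the join of `i` and `j` (with respect to `⊆`). -/
def isJoin {n : ℕ} (k i j : Fin n) : BF n :=
  sub' i k ⊓ sub' j k ⊓
    ∀' ((sub' i.castSucc (Fin.last n) ⊓ sub' j.castSucc (Fin.last n)) ⟹
      sub' k.castSucc (Fin.last n))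

/-- The meet of `i` and `j` is `⊥`. -/
def meetIsBot {n : ℕ} (i j : Fin n) : BF n :=
  ∀' ((sub' (Fin.last n) i.castSucc ⊓ sub' (Fin.last n) j.castSucc) ⟹ isBot' (Fin.last n))

/-- The join of `i` and `j` is the top element. -/
def joinIsTop {n : ℕ} (i j : Fin n) : BF n :=
  ∀' ((sub' i.castSucc (Fin.last n) ⊓ sub' j.castSucc (Fin.last n)) ⟹
    ∀' (sub' (Fin.last (n + 1)) ((Fin.last n).castSucc)))

/-- `j` is a (Boolean) complement of `i`. -/
def isComplOf {n : ℕ} (j i : Fin n) : BF n := meetIsBot i j ⊓ joinIsTop i j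

/-- `i` is an atom: non-bottom, and minimal among non-bottom elements. -/
def isAtomDef {n : ℕ} (i : Fin n) : BF n :=
  ∼(isBot' i) ⊓
    ∀' (sub' (Fin.last n) i.castSucc ⟹ (isBot' (Fin.last n) ⊔ eq' (Fin.last n) i.castSucc))

/-! ### The base theory `T_base` -/

def axRefl : Lmso.Sentence := ∀' sub' 0 0
def axAntisymm : Lmso.Sentence := ∀' ∀' ((sub' 0 1 ⊓ sub' 1 0) ⟹ eq' 0 1)
def axTrans : Lmso.Sentence := ∀' ∀' ∀' ((sub' 0 1 ⊓ sub' 1 2) ⟹ sub' 0 2)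
def axBotLe : Lmso.Sentence := ∀' botSub' 0
def axTop : Lmso.Sentence := ∃' ∀' (sub' 1 0)
def axMeet : Lmso.Sentence := ∀' ∀' ∃' (isMeet 2 0 1)
def axJoin : Lmso.Sentence := ∀' ∀' ∃' (isJoin 2 0 1)
def axCompl : Lmso.Sentence := ∀' ∃' (isComplOf 1 0)
def axDistrib : Lmso.Sentence :=
  ∀' ∀' ∀' ∀' ∀' ∀' ∀' ∀'
    ((isMeet 3 0 1 ⊓ isMeet 4 0 2 ⊓ isJoin 5 1 2 ⊓ isMeet 6 0 5 ⊓ isJoin 7 3 4) ⟹ sub' 6 7)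
def axAt : Lmso.Sentence := ∀' (at' 0 ⇔ isAtomDef 0)
def axAtomic : Lmso.Sentence := ∀' (∼(isBot' 0) ⟹ ∃' (at' 1 ⊓ sub' 1 0))
def axIrrefl : Lmso.Sentence := ∀' (at' 0 ⟹ ∼(exle' 0 0))
def axTransAt : Lmso.Sentence :=
  ∀' ∀' ∀' ((at' 0 ⊓ at' 1 ⊓ at' 2 ⊓ exle' 0 1 ⊓ exle' 1 2) ⟹ exle' 0 2)
def axTrich : Lmso.Sentence :=
  ∀' ∀' ((at' 0 ⊓ at' 1) ⟹ (exle' 0 1 ⊔ eq' 0 1 ⊔ exle' 1 0))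
def axExleDef : Lmso.Sentence :=
  ∀' ∀' (exle' 0 1 ⇔ ∃' ∃' (at' 2 ⊓ at' 3 ⊓ sub' 2 0 ⊓ sub' 3 1 ⊓ exle' 2 3))

/-- The comprehension axiom for a formula `η(x; Y₁,…,Yₙ)` (with `x` the last variable):
`∀ Ȳ ∃ X ∀ x (At x → (x ⊆ X ↔ η(x; Ȳ)))`. -/
def compAx {n : ℕ} (η : BF (n + 1)) : Lmso.Sentence :=
  BoundedFormula.alls (∃' ∀' (at' (Fin.last (n + 1)) ⟹
    (sub' (Fin.last (n + 1)) ((Fin.last n).castSucc) ⇔ η.liftAt 1 n)))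

/-- The base theory `T_base`: an atomic Boolean algebra under `⊆` with bottom `⊥`, `At`
holding exactly of the atoms, `≤ᴱ` linearly ordering the atoms and determined by its
restriction to the atoms, together with the comprehension scheme. -/
def Tbase : Lmso.Theory :=
  {axRefl, axAntisymm, axTrans, axBotLe, axTop, axMeet, axJoin, axCompl, axDistrib,
    axAt, axAtomic, axIrrefl, axTransAt, axTrich, axExleDef} ∪
  ⋃ n : ℕ, Set.range (compAx (n := n))

/-! ### The theory `T_MSO(Fin)` -/

/-- `i` is the `≤ᴱ`-least atom. -/
def isLeastAtom {n : ℕ} (i : Fin n) : BF n :=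
  at' i ⊓ ∀' (at' (Fin.last n) ⟹ ∼(exle' (Fin.last n) i.castSucc))

/-- `i` is the `≤ᴱ`-greatest atom. -/
def isGreatestAtom {n : ℕ} (i : Fin n) : BF n :=
  at' i ⊓ ∀' (at' (Fin.last n) ⟹ ∼(exle' i.castSucc (Fin.last n)))

/-- `j` is the immediate `≤ᴱ`-successor of the atom `i`. -/
def isSuccOf {n : ℕ} (j i : Fin n) : BF n :=
  at' i ⊓ at' j ⊓ exle' i j ⊓
    ∀' ((at' (Fin.last n) ⊓ exle' i.castSucc (Fin.last n)) ⟹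
      (eq' (Fin.last n) j.castSucc ⊔ exle' j.castSucc (Fin.last n)))

def axLeastAtom : Lmso.Sentence := (∃' at' 0) ⟹ ∃' isLeastAtom 0
def axGreatestAtom : Lmso.Sentence := (∃' at' 0) ⟹ ∃' isGreatestAtom 0
def axSucc : Lmso.Sentence :=
  ∀' ((at' 0 ⊓ ∃' (at' 1 ⊓ exle' 0 1)) ⟹ ∃' isSuccOf 1 0)
def axPred : Lmso.Sentence :=
  ∀' ((at' 0 ⊓ ∃' (at' 1 ⊓ exle' 1 0)) ⟹ ∃' isSuccOf 0 1)
def axLeastIn : Lmso.Sentence :=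
  ∀' (∼(isBot' 0) ⟹ ∃' (at' 1 ⊓ sub' 1 0 ⊓ ∀' ((at' 2 ⊓ sub' 2 0) ⟹ ∼(exle' 2 1))))

/-- The theory `T_MSO(Fin)`: `T_base` together with axioms saying that the ordering of the
atoms is discrete with endpoints, and every non-bottom element contains a least atom. -/
def TMSOFin : Lmso.Theory :=
  Tbase ∪ {axLeastAtom, axGreatestAtom, axSucc, axPred, axLeastIn}

/-! ### Quantifier rank, unnested formulas, and `≈ₖ` -/

/-- Quantifier rank of a bounded formula. -/
def qr : ∀ {n : ℕ}, BF n → ℕ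
  | _, BoundedFormula.falsum => 0
  | _, BoundedFormula.equal _ _ => 0
  | _, BoundedFormula.rel _ _ => 0
  | _, BoundedFormula.imp f g => max (qr f) (qr g)
  | _, BoundedFormula.all f => qr f + 1

/-- A formula is unnested if every atomic subformula is of one of the forms
`x = y`, `c = y`, or `R x̄` with the `xᵢ`, `y` variables (Hodges). -/
def IsUnnested : ∀ {n : ℕ}, BF n → Prop
  | _, BoundedFormula.falsum => True
  | _, BoundedFormula.equal s t =>
      (∃ i j, s = Term.var i ∧ t = Term.var j) ∨
      (∃ (c : Lmso.Constants) (j : _), s = Constants.term c ∧ t = Term.var j)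
  | _, BoundedFormula.rel _ ts => ∀ i, ∃ j, ts i = Term.var j
  | _, BoundedFormula.imp f g => IsUnnested f ∧ IsUnnested g
  | _, BoundedFormula.all f => IsUnnested f

/-- `M ≈ₖ N` : `M` and `N` satisfy the same unnested `L_⊗`-sentences of quantifier
rank at most `k`. -/
def EquivK (k : ℕ) (M N : Type*) [Lmso.Structure M] [Lmso.Structure N] : Prop :=
  ∀ φ : Lmso.Sentence, IsUnnested φ → qr φ ≤ k → (M ⊨ φ ↔ N ⊨ φ)

/-! ### The sentences `ρ_{d,h}`, `ψ_{>n}`, `ψ_{=n}` -/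

/-- The index (in `Fin d`) of `A_h` among `A₁, …, A_d`, identifying `h = 0` with `h = d`. -/
def aIdx (d h : ℕ) (hd : 0 < d) : Fin d := ⟨(h + d - 1) % d, Nat.mod_lt _ hd⟩

/-- The cyclic successor on the indices `{1, …, d}`. -/
def cyc {d : ℕ} (j : Fin d) : Fin d := ⟨((j : ℕ) + 1) % d, Nat.mod_lt _ j.pos⟩

/-- The sentence `ρ_{d,h}`: there is a partition of the atoms into `d` non-bottom elements
`A₁, …, A_d` such that the least atom is in `A₁`, the immediate successor of an atom lying in
`A_j` lies in `A_{j+1}` (cyclically), and the greatest atom is in `A_h`. -/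
def rho (d h : ℕ) : Lmso.Sentence :=
  if hd : 0 < d then
    BoundedFormula.exs (n := d) (
      -- each `A_i` is non-bottom
      bigAnd ((List.finRange d).map fun i => ∼(isBot' i)) ⊓
      -- every atom lies in some `A_i`
      (∀' (at' (Fin.last d) ⟹
        bigOr ((List.finRange d).map fun i => sub' (Fin.last d) i.castSucc))) ⊓
      -- the `A_i` are pairwise disjoint on atoms
      bigAnd ((List.finRange d).flatMap fun i => (List.finRange d).filterMap fun j =>
        if i.val < j.val then
          some (∀' (at' (Fin.last d) ⟹
            ∼(sub' (Fin.last d) i.castSucc ⊓ sub' (Fin.last d) j.castSucc)))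
        else none) ⊓
      -- the least atom lies in `A₁`
      (∀' (isLeastAtom (Fin.last d) ⟹ sub' (Fin.last d) ((aIdx d 1 hd).castSucc))) ⊓
      -- immediate successors move cyclically through the `A_j`
      bigAnd ((List.finRange d).map fun j =>
        ∀' ∀' ((sub' ((Fin.last d).castSucc) (j.castSucc.castSucc) ⊓
            isSuccOf (Fin.last (d + 1)) ((Fin.last d).castSucc)) ⟹
          sub' (Fin.last (d + 1)) ((cyc j).castSucc.castSucc))) ⊓
      -- the greatest atom lies in `A_h`
      (∀' (isGreatestAtom (Fin.last d) ⟹ sub' (Fin.last d) ((aIdx d h hd).castSucc))))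
  else ⊥

/-- The list of formulas `xᵢ ≠ xⱼ` for `i < j < n`. -/
def distinctPairs (n : ℕ) : List (BF n) :=
  (List.finRange n).flatMap fun i => (List.finRange n).filterMap fun j =>
    if i.val < j.val then some (∼(eq' i j)) else none

/-- `ψ_{>n}` : there exist at least `n + 1` distinct atoms. -/
def psiGt (n : ℕ) : Lmso.Sentence :=
  BoundedFormula.exs (n := n + 1)
    (bigAnd ((List.finRange (n + 1)).map fun i => at' i) ⊓ bigAnd (distinctPairs (n + 1)))

/-- `ψ_{=n}` : there exist exactly `n` distinct atoms. -/
def psiEq (n : ℕ) : Lmso.Sentence :=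
  BoundedFormula.exs (n := n)
    (bigAnd ((List.finRange n).map fun i => at' i) ⊓ bigAnd (distinctPairs n) ⊓
      ∀' (at' (Fin.last n) ⟹ bigOr ((List.finRange n).map fun i => eq' (Fin.last n) i.castSucc)))

/-! ### Residue functions and the theories `T_r̃` -/

/-- A residue function `ℙ × ℕ_{>0} → ℕ` (conditions imposed only at primes `p` and `j ≥ 1`):
`r(p,j) < p^j` and `r(p,j+1) ≡ r(p,j) [MOD p^j]`. -/
def IsResidueFunction (r : ℕ → ℕ → ℕ) : Prop :=
  ∀ p j : ℕ, p.Prime → 1 ≤ j → r p j < p ^ j ∧ r p (j + 1) ≡ r p j [MOD p ^ j]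

/-- A function `ℕ_{>1} → ℕ` is a residue function if it arises from a residue function
`ℙ × ℕ_{>0} → ℕ` as in the paper (conditions imposed only for `d > 1`). -/
def IsResidueFunctionTilde (rt : ℕ → ℕ) : Prop :=
  ∃ r : ℕ → ℕ → ℕ, IsResidueFunction r ∧
    ∀ d : ℕ, 1 < d → rt d < d ∧
      ∀ p j : ℕ, p.Prime → 1 ≤ j → p ^ j ∣ d → rt d ≡ r p j [MOD p ^ j]

/-- The theory `T_r̃ = T_MSO(Fin) ∪ {ψ_{>n} : n ∈ ℕ} ∪ {ρ_{d,r̃(d)} : d > 1}`. -/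
def Trt (rt : ℕ → ℕ) : Lmso.Theory :=
  TMSOFin ∪ Set.range psiGt ∪ {σ : Lmso.Sentence | ∃ d : ℕ, 1 < d ∧ σ = rho d (rt d)}

/-! ### Relativization and the sum of sentences -/

/-- Relativization of a formula to the elements `⊆ v`:
each quantifier `∀ Z (…)` becomes `∀ Z (Z ⊆ v → …)`. -/
def relv : ∀ {n : ℕ}, BF n → Fin n → BF n
  | _, BoundedFormula.falsum, _ => BoundedFormula.falsum
  | _, BoundedFormula.equal s t, _ => BoundedFormula.equal s t
  | _, BoundedFormula.rel r ts, _ => BoundedFormula.rel r ts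
  | _, BoundedFormula.imp f g, v => (relv f v).imp (relv g v)
  | n, BoundedFormula.all f, v =>
      BoundedFormula.all (sub' (Fin.last n) v.castSucc ⟹ relv f v.castSucc)

/-- `i` is downward closed with respect to the `≤ᴱ`-ordering of the atoms. -/
def dwcl' {n : ℕ} (i : Fin n) : BF n :=
  ∀' ∀' ((at' ((Fin.last n).castSucc) ⊓ at' (Fin.last (n + 1)) ⊓
      sub' ((Fin.last n).castSucc) (i.castSucc.castSucc) ⊓
      exle' (Fin.last (n + 1)) ((Fin.last n).castSucc)) ⟹
    sub' (Fin.last (n + 1)) (i.castSucc.castSucc))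

/-- The sentence `φ + ψ` : `∃ X (X downward closed ∧ φ^X ∧ ψ^(Xᶜ))`
(with the complement `Xᶜ` introduced by an existential quantifier). -/
def plusSent (φ ψ : Lmso.Sentence) : Lmso.Sentence :=
  ∃' ∃' (dwcl' (0 : Fin 2) ⊓ isComplOf (1 : Fin 2) (0 : Fin 2) ⊓
    relv (φ.liftAt 2 0) (0 : Fin 2) ⊓ relv (ψ.liftAt 2 0) (1 : Fin 2))

/-! ### `FSpec` and ultimate periodicity -/

/-- `FSpec φ` : the set of `n ∈ ℕ` such that `MSO(n) ⊨ φ`. -/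
def FSpec (φ : Lmso.Sentence) : Set ℕ := {n : ℕ | MSOn n ⊨ φ}

/-- A set of naturals is ultimately periodic. -/
def UltPeriodic (S : Set ℕ) : Prop :=
  ∃ N d : ℕ, 0 < d ∧ ∀ n : ℕ, N < n → (n ∈ S ↔ n + d ∈ S)

/-! ### The language `L_MO = {⊆, <}` -/

/-- The language `L_MO` with two binary relations: `⊆` (encoded `true`) and `<`
(encoded `false`). -/
def Lmo : Language where
  Functions := fun _ => Empty
  Relations := fun n => match n with | 2 => Bool | _ => Empty

/-- The monadic second order version `MSO(α)` of a linear order `α` as an `L_MO`-structure: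
`⊆` is inclusion and `<` is the ordering of `α` on singletons. -/
instance moStructure (α : Type*) [LinearOrder α] : Lmo.Structure (Set α) where
  funMap := fun f _ => f.elim
  RelMap := fun {n} r v => match n, r with
    | 2, true => v 0 ⊆ v 1
    | 2, false => ∃ a b : α, v 0 = {a} ∧ v 1 = {b} ∧ a < b

/-! ### Boolean-algebra facts about models -/

/-- `⊥` is the `⊆`-least element and `At` holds exactly of the minimal elements other than `⊥`. -/
structure AtomsMinimal (M : Type*) [Lmso.Structure M] : Prop where
  sub_refl : ∀ a : M, subE a a
  bot_sub : ∀ a : M, subE (botE M) a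
  eq_bot_of_sub : ∀ a : M, subE a (botE M) → a = botE M
  atE_iff : ∀ a : M, atE a ↔ a ≠ botE M ∧ ∀ q : M, subE q a → q = botE M ∨ q = a

theorem botE_set (α : Type*) [LinearOrder α] : botE (Set α) = ∅ := rfl

theorem subE_set {α : Type*} [LinearOrder α] (a b : Set α) : subE a b ↔ a ⊆ b := Iff.rfl

theorem exleE_set {α : Type*} [LinearOrder α] (a b : Set α) :
    exleE a b ↔ ∃ x ∈ a, ∃ y ∈ b, x < y := Iff.rfl

theorem atE_set {α : Type*} [LinearOrder α] (a : Set α) : atE a ↔ ∃ x, a = {x} := Iff.rfl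

theorem atomsMinimal_set (α : Type*) [LinearOrder α] : AtomsMinimal (Set α) where
  sub_refl := Set.Subset.refl
  bot_sub := Set.empty_subset
  eq_bot_of_sub := fun _ => Set.subset_empty_iff.1
  atE_iff a := by
    simp only [atE_set, botE_set, subE_set]
    constructor
    · rintro ⟨x, rfl⟩
      exact ⟨Set.singleton_ne_empty x, fun q => Set.subset_singleton_iff_eq.1⟩
    · rintro ⟨hne, h⟩
      obtain ⟨x, hx⟩ := Set.nonempty_iff_ne_empty.2 hne
      refine ⟨x, ?_⟩
      rcases h {x} (Set.singleton_subset_iff.2 hx) with h | h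
      · exact absurd h (Set.singleton_ne_empty x)
      · exact h.symm

section Realize

variable {M : Type*} [Lmso.Structure M] {m : ℕ} (v : Empty → M) (xs : Fin m → M)

theorem realize_tb : (tb : Lmso.Term (Empty ⊕ Fin m)).realize (Sum.elim v xs) = botE M := by
  simp only [tb, botE]
  exact (Term.realize_constants).trans
    (congrArg (Structure.funMap botC) (Subsingleton.elim _ _))

theorem realize_sub' (i j : Fin m) : (sub' i j).Realize v xs ↔ subE (xs i) (xs j) := by
  simp [sub', subE, tv, BoundedFormula.realize_rel₂]

theorem realize_exle' (i j : Fin m) : (exle' i j).Realize v xs ↔ exleE (xs i) (xs j) := by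
  simp [exle', exleE, tv, BoundedFormula.realize_rel₂]

theorem realize_at' (i : Fin m) : (at' i).Realize v xs ↔ atE (xs i) := by
  simp [at', atE, tv, BoundedFormula.realize_rel₁]

theorem realize_eq' (i j : Fin m) : (eq' i j).Realize v xs ↔ xs i = xs j := by
  simp [eq', tv]

theorem realize_isBot' (i : Fin m) : (isBot' i).Realize v xs ↔ xs i = botE M := by
  simp [isBot', tv, realize_tb]

theorem realize_botSub' (i : Fin m) : (botSub' i).Realize v xs ↔ subE (botE M) (xs i) := by
  simp [botSub', subE, tv, BoundedFormula.realize_rel₂, realize_tb]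

theorem realize_isAtomDef (i : Fin m) : (isAtomDef i).Realize v xs ↔
    xs i ≠ botE M ∧ ∀ q : M, subE q (xs i) → q = botE M ∨ q = xs i := by
  simp [isAtomDef, realize_isBot', realize_sub', realize_eq']

end Realize

theorem atomsMinimal_of_model {M : Type*} [Lmso.Structure M] (hM : M ⊨ Tbase) :
    AtomsMinimal M := by
  have hrefl : M ⊨ axRefl := hM.realize_of_mem _ (by simp [Tbase])
  have hanti : M ⊨ axAntisymm := hM.realize_of_mem _ (by simp [Tbase])
  have hbot : M ⊨ axBotLe := hM.realize_of_mem _ (by simp [Tbase])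
  have hat : M ⊨ axAt := hM.realize_of_mem _ (by simp [Tbase])
  simp only [Sentence.Realize, Formula.Realize, axRefl, axAntisymm, axBotLe,
    axAt,
    BoundedFormula.realize_all, BoundedFormula.realize_imp, BoundedFormula.realize_inf,
    BoundedFormula.realize_iff, realize_sub', realize_eq', realize_botSub', realize_at',
    realize_isAtomDef] at hrefl hanti hbot hat
  exact ⟨hrefl, hbot, fun a h => hanti a _ ⟨h, hbot a⟩, hat⟩

/-! ### The tensor product -/

section Tensor

variable {M N : Type*} [Lmso.Structure M] [Lmso.Structure N]

theorem botE_prod : botE (M × N) = (botE M, botE N) := rfl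

theorem subE_prod (p q : M × N) : subE p q ↔ subE p.1 q.1 ∧ subE p.2 q.2 := Iff.rfl

theorem exleE_prod (p q : M × N) : exleE p q ↔
    (p.1 ≠ botE M ∧ q.2 ≠ botE N) ∨ exleE p.1 q.1 ∨ exleE p.2 q.2 := Iff.rfl

theorem atE_prod (p : M × N) : atE p ↔
    p ≠ botE (M × N) ∧ ∀ q : M × N, subE q p → q = botE (M × N) ∨ q = p :=
  ⟨fun h => ⟨h.1, fun q hq => h.2 q hq.1 hq.2⟩, fun h => ⟨h.1, fun q h₁ h₂ => h.2 q ⟨h₁, h₂⟩⟩⟩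

theorem atE_prod_iff (hM : AtomsMinimal M) (hN : AtomsMinimal N) (p : M × N) :
    atE p ↔ (atE p.1 ∧ p.2 = botE N) ∨ (p.1 = botE M ∧ atE p.2) := by
  obtain ⟨a, b⟩ := p
  simp only [atE_prod, hM.atE_iff, hN.atE_iff, botE_prod, subE_prod, ne_eq, Prod.forall,
    Prod.mk.injEq]
  have hMb := hM.bot_sub
  have hNb := hN.bot_sub
  have hMe := hM.eq_bot_of_sub
  have hNe := hN.eq_bot_of_sub
  constructor
  · rintro ⟨hne, h⟩
    by_cases ha : a = botE M
    · subst ha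
      exact .inr ⟨rfl, by simpa using hne, fun q hq => by simpa using h _ q ⟨hMb _, hq⟩⟩
    · by_cases hb : b = botE N
      · subst hb
        exact .inl ⟨⟨ha, fun q hq => by simpa using h q _ ⟨hq, hNb _⟩⟩, rfl⟩
      · rcases h a (botE N) ⟨hM.sub_refl a, hNb b⟩ with h | h
        · exact absurd h.1 ha
        · exact absurd h.2.symm hb
  · rintro (⟨⟨hne, h⟩, rfl⟩ | ⟨rfl, hne, h⟩)
    · refine ⟨fun h => hne h.1, fun q r hqr => ?_⟩
      obtain rfl := hNe r hqr.2
      simpa using h q hqr.1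
    · refine ⟨fun h => hne h.2, fun q r hqr => ?_⟩
      obtain rfl := hMe q hqr.1
      simpa using h r hqr.2

end Tensor

/-! ### Translating formulas about `M ⊗ N` into formulas about `M`, for finite `N` -/

theorem qr_bigAnd_le {m r : ℕ} (l : List (BF m)) (h : ∀ φ ∈ l, qr φ ≤ r) : qr (bigAnd l) ≤ r := by
  induction l with
  | nil => exact Nat.zero_le _
  | cons φ l ih =>
    simp only [List.mem_cons, forall_eq_or_imp] at h
    have := ih h.2
    change max (max (qr φ) (max (qr (bigAnd l)) 0)) 0 ≤ r
    omega

theorem isUnnested_bigAnd {m : ℕ} (l : List (BF m)) (h : ∀ φ ∈ l, IsUnnested φ) :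
    IsUnnested (bigAnd l) := by
  induction l with
  | nil => exact ⟨trivial, trivial⟩
  | cons φ l ih =>
    simp only [List.mem_cons, forall_eq_or_imp] at h
    exact ⟨⟨h.1, ih h.2, trivial⟩, trivial⟩

theorem realize_bigAnd {M : Type*} [Lmso.Structure M] {m : ℕ} (l : List (BF m)) (v : Empty → M)
    (xs : Fin m → M) : (bigAnd l).Realize v xs ↔ ∀ φ ∈ l, φ.Realize v xs :=
  BoundedFormula.realize_foldr_inf l v xs

/-- `P` is uniformly defined, over models whose atoms are minimal, by an unnested formula of
quantifier rank at most `r`. -/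
def UnnestedDefinable {m : ℕ} (r : ℕ) (P : ∀ (M : Type) [Lmso.Structure M], (Fin m → M) → Prop) :
    Prop :=
  ∃ ψ : BF m, IsUnnested ψ ∧ qr ψ ≤ r ∧ ∀ (M : Type) [Lmso.Structure M], AtomsMinimal M →
    ∀ xs : Fin m → M, ψ.Realize default xs ↔ P M xs

namespace UnnestedDefinable

variable {m r : ℕ} {P Q : ∀ (M : Type) [Lmso.Structure M], (Fin m → M) → Prop}

theorem congr (hP : UnnestedDefinable r P)
    (h : ∀ (M : Type) [Lmso.Structure M], AtomsMinimal M → ∀ xs, P M xs ↔ Q M xs) :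
    UnnestedDefinable r Q := by
  obtain ⟨φ, hu, hq, hr⟩ := hP
  exact ⟨φ, hu, hq, fun M _ hM xs => (hr M hM xs).trans (h M hM xs)⟩

theorem false : UnnestedDefinable (m := m) r fun _ _ _ => False :=
  ⟨⊥, trivial, Nat.zero_le _, fun _ _ _ _ => Iff.rfl⟩

theorem imp (hP : UnnestedDefinable r P) (hQ : UnnestedDefinable r Q) :
    UnnestedDefinable r fun M _ xs => P M xs → Q M xs := by
  obtain ⟨φ, hu, hq, hr⟩ := hP
  obtain ⟨ψ, hu', hq', hr'⟩ := hQ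
  exact ⟨φ ⟹ ψ, ⟨hu, hu'⟩, max_le hq hq', fun M _ hM xs => imp_congr (hr M hM xs) (hr' M hM xs)⟩

theorem not (hP : UnnestedDefinable r P) : UnnestedDefinable r fun M _ xs => ¬ P M xs :=
  hP.imp false

theorem or (hP : UnnestedDefinable r P) (hQ : UnnestedDefinable r Q) :
    UnnestedDefinable r fun M _ xs => P M xs ∨ Q M xs :=
  (hP.not.imp hQ).congr fun _ _ _ _ => or_iff_not_imp_left.symm

theorem and (hP : UnnestedDefinable r P) (hQ : UnnestedDefinable r Q) :
    UnnestedDefinable r fun M _ xs => P M xs ∧ Q M xs :=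
  (hP.imp hQ.not).not.congr fun _ _ _ _ => by tauto

theorem const (p : Prop) : UnnestedDefinable (m := m) r fun _ _ _ => p := by
  by_cases hp : p
  · exact false.not.congr fun _ _ _ _ => by simp [hp]
  · exact false.congr fun _ _ _ _ => by simp [hp]

theorem forall_finite {ι : Type*} [Finite ι]
    {P : ι → ∀ (M : Type) [Lmso.Structure M], (Fin m → M) → Prop}
    (hP : ∀ i, UnnestedDefinable r (P i)) :
    UnnestedDefinable r fun M _ xs => ∀ i, P i M xs := by
  have := Fintype.ofFinite ι
  choose φ hu hq hr using hP
  refine ⟨bigAnd (Finset.univ.toList.map φ), isUnnested_bigAnd _ ?_, qr_bigAnd_le _ ?_,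
    fun M _ hM xs => ?_⟩
  · simpa using hu
  · simpa using hq
  · simp [realize_bigAnd, hr _ M hM]

theorem all {P : ∀ (M : Type) [Lmso.Structure M], (Fin (m + 1) → M) → Prop}
    (hP : UnnestedDefinable r P) :
    UnnestedDefinable (r + 1) fun M _ xs => ∀ a : M, P M (Fin.snoc xs a) := by
  obtain ⟨φ, hu, hq, hr⟩ := hP
  exact ⟨φ.all, hu, Nat.succ_le_succ hq, fun M _ hM xs => forall_congr' fun a => hr M hM _⟩

theorem sub (i j : Fin m) : UnnestedDefinable r fun _ _ xs => subE (xs i) (xs j) := by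
  refine ⟨sub' i j, fun t => ?_, Nat.zero_le _, fun M _ _ xs => realize_sub' _ xs i j⟩
  fin_cases t
  exacts [⟨_, rfl⟩, ⟨_, rfl⟩]

theorem exle (i j : Fin m) : UnnestedDefinable r fun _ _ xs => exleE (xs i) (xs j) := by
  refine ⟨exle' i j, fun t => ?_, Nat.zero_le _, fun M _ _ xs => realize_exle' _ xs i j⟩
  fin_cases t
  exacts [⟨_, rfl⟩, ⟨_, rfl⟩]

theorem atom (i : Fin m) : UnnestedDefinable r fun _ _ xs => atE (xs i) := by
  refine ⟨at' i, fun t => ?_, Nat.zero_le _, fun M _ _ xs => realize_at' _ xs i⟩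
  fin_cases t
  exact ⟨_, rfl⟩

theorem eq (i j : Fin m) : UnnestedDefinable r fun _ _ xs => xs i = xs j :=
  ⟨eq' i j, .inl ⟨_, _, rfl, rfl⟩, Nat.zero_le _, fun _ _ _ xs => realize_eq' _ xs i j⟩

theorem isBot (i : Fin m) : UnnestedDefinable r fun M _ xs => xs i = botE M :=
  ⟨tb.bdEqual (tv i), .inr ⟨botC, _, rfl, rfl⟩, Nat.zero_le _, fun M _ _ xs => by
    rw [BoundedFormula.realize_bdEqual, realize_tb, eq_comm]; rfl⟩

end UnnestedDefinable

theorem unnestedDefinable_prod {N : Type*} [Finite N] [Lmso.Structure N] (hN : AtomsMinimal N)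
    {m : ℕ} (φ : BF m) (hφ : IsUnnested φ) (B : Fin m → N) :
    UnnestedDefinable (qr φ) fun M _ xs =>
      φ.Realize (M := M × N) default fun i => (xs i, B i) := by
  induction φ with
  | falsum => exact .false
  | equal s t =>
    rcases hφ with ⟨⟨⟨⟩⟩ | i, ⟨⟨⟩⟩ | j, rfl, rfl⟩ | ⟨c, ⟨⟨⟩⟩ | j, rfl, rfl⟩
    · exact ((UnnestedDefinable.eq i j).and (.const (B i = B j))).congr fun M _ _ xs =>
        Prod.mk_inj.symm.trans (realize_eq' (M := M × N) default
          (fun i => (xs i, B i)) i j).symm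
    · obtain rfl : c = botC := rfl
      refine ((UnnestedDefinable.isBot j).and (.const (B j = botE N))).congr fun M _ _ xs => ?_
      refine Prod.mk_inj.symm.trans (eq_comm.trans ?_)
      change botE (M × N) = _ ↔ tb.realize _ = _
      rw [realize_tb]
      rfl
  | @rel m l R ts =>
    choose j hj using hφ
    obtain rfl : ts = fun i => Term.var (j i) := funext hj
    have hvar : ∀ i, ∃ j', j i = Sum.inr j' := fun i => by
      rcases j i with e | j'
      exacts [e.elim, ⟨j', rfl⟩]
    choose j' hj' using hvar
    obtain rfl : j = fun i => Sum.inr (j' i) := funext hj'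
    match l, R with
    | 1, () =>
      refine (((UnnestedDefinable.atom (j' 0)).and (.const (B (j' 0) = botE N))).or
        ((UnnestedDefinable.isBot (j' 0)).and (.const (atE (B (j' 0)))))).congr
        fun M _ hM xs => ?_
      exact (atE_prod_iff hM hN (xs (j' 0), B (j' 0))).symm
    | 2, true =>
      exact ((UnnestedDefinable.sub (j' 0) (j' 1)).and
        (.const (subE (B (j' 0)) (B (j' 1))))).congr fun M _ hM xs => Iff.rfl
    | 2, false =>
      exact (((UnnestedDefinable.isBot (j' 0)).not.and (.const (B (j' 1) ≠ botE N))).or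
        ((UnnestedDefinable.exle (j' 0) (j' 1)).or
          (.const (exleE (B (j' 0)) (B (j' 1)))))).congr fun M _ hM xs => Iff.rfl
  | imp φ ψ ihφ ihψ =>
    have weaken {m r s : ℕ} {P} (h : UnnestedDefinable (m := m) r P) (hrs : r ≤ s) :
        UnnestedDefinable s P := by
      obtain ⟨φ, hu, hq, hr⟩ := h
      exact ⟨φ, hu, hq.trans hrs, hr⟩
    exact (weaken (ihφ hφ.1 B) (le_max_left _ _)).imp (weaken (ihψ hφ.2 B) (le_max_right _ _))
  | all φ ih =>
    refine (UnnestedDefinable.all (UnnestedDefinable.forall_finite fun b : N =>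
      ih hφ (Fin.snoc B b))).congr fun M _ _ xs => ?_
    rw [BoundedFormula.realize_all, Prod.forall]
    refine forall_congr' fun a => forall_congr' fun b => ?_
    refine iff_of_eq (congrArg _ (funext fun i => ?_))
    refine Fin.lastCases ?_ (fun i => ?_) i <;> simp

/-- Tensoring with a finite structure preserves `≈ₖ`. -/
theorem EquivK.prod {M M' N : Type} [Finite N] [Lmso.Structure M] [Lmso.Structure M']
    [Lmso.Structure N] {k : ℕ} (h : EquivK k M M') (hM : AtomsMinimal M) (hM' : AtomsMinimal M')
    (hN : AtomsMinimal N) : EquivK k (M × N) (M' × N) := by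
  intro φ hu hq
  obtain ⟨ψ, hψu, hψq, hψ⟩ := unnestedDefinable_prod hN φ hu default
  have key (K : Type) [Lmso.Structure K] (hK : AtomsMinimal K) : K ⊨ ψ ↔ (K × N) ⊨ φ :=
    (hψ K hK default).trans (iff_of_eq (congrArg _ (Subsingleton.elim _ _)))
  exact (key M hM).symm.trans ((h ψ hψu (hψq.trans hq)).trans (key M' hM'))

/-! ### Adding a last point to a finite linear order -/

/-- A subset of `Fin (n + 1)` is a subset of `Fin n` together with a subset of the last point. -/
def setFinSuccEquiv (n : ℕ) : Set (Fin (n + 1)) ≃ Set (Fin n) × Set (Fin 1) where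
  toFun S := ({i | i.castSucc ∈ S}, {_x | Fin.last n ∈ S})
  invFun p := {i | (∃ j ∈ p.1, i = j.castSucc) ∨ (i = Fin.last n ∧ 0 ∈ p.2)}
  left_inv S := by
    ext i
    refine Fin.lastCases ?_ (fun i => ?_) i <;> simp [(Fin.castSucc_ne_last _).symm]
  right_inv p := by
    refine Prod.ext (Set.ext fun i => ?_) (Set.ext fun i => ?_)
    · simp
    · simp [Subsingleton.elim i 0, (Fin.castSucc_ne_last _).symm]

theorem subE_setFinSuccEquiv {n : ℕ} (S T : Set (Fin (n + 1))) :
    subE (setFinSuccEquiv n S) (setFinSuccEquiv n T) ↔ subE S T := by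
  simp [subE_prod, subE_set, setFinSuccEquiv, Set.subset_def, Fin.forall_fin_succ']

theorem exleE_setFinSuccEquiv {n : ℕ} (S T : Set (Fin (n + 1))) :
    exleE (setFinSuccEquiv n S) (setFinSuccEquiv n T) ↔ exleE S T := by
  simp only [exleE_prod, exleE_set, botE_set, setFinSuccEquiv, Equiv.coe_fn_mk, ne_eq,
    ← Set.nonempty_iff_ne_empty, Set.Nonempty, Set.mem_ofPred_eq, Fin.exists_fin_succ',
    Fin.castSucc_lt_castSucc_iff, Fin.castSucc_lt_last, lt_self_iff_false]
  have := fun i : Fin n => (Fin.castSucc_lt_last i).not_gt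
  simp only [this]
  simp
  grind

theorem atE_setFinSuccEquiv {n : ℕ} (S : Set (Fin (n + 1))) :
    atE (setFinSuccEquiv n S) ↔ atE S := by
  have hbot : botE (Set (Fin n) × Set (Fin 1)) = setFinSuccEquiv n (botE (Set (Fin (n + 1)))) :=
    rfl
  simp only [atE_prod, (atomsMinimal_set (Fin (n + 1))).atE_iff, hbot, ne_eq,
    (setFinSuccEquiv n).surjective.forall, subE_setFinSuccEquiv, EmbeddingLike.apply_eq_iff_eq]

/-- `MSO(n + 1)` is isomorphic to `MSO(n) ⊗ MSO(1)`. -/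
def msoSuccEquiv (n : ℕ) : MSOn (n + 1) ≃[Lmso] MSOn n × MSOn 1 where
  toEquiv := setFinSuccEquiv n
  map_fun' {l} f xs := by
    match l, f with
    | 0, () => rfl
  map_rel' {l} R xs := by
    match l, R with
    | 1, () => exact atE_setFinSuccEquiv (xs 0)
    | 2, true => exact subE_setFinSuccEquiv (xs 0) (xs 1)
    | 2, false => exact exleE_setFinSuccEquiv (xs 0) (xs 1)

theorem statement5 (M : Type) [Lmso.Structure M] (hM : M ⊨ TMSOFin) (k n : ℕ)
    (h : EquivK k M (MSOn n)) : EquivK k (M × MSOn 1) (MSOn (n + 1)) := by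
  exact fun φ hu hq => ((h.prod (atomsMinimal_of_model (hM.mono Set.subset_union_left))
    (atomsMinimal_set _) (atomsMinimal_set _)) φ hu hq).trans
    (StrongHomClass.realize_sentence (msoSuccEquiv n) φ).symm

end MSO
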